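/- If H is an infinite normal subgroup of a Morse local-to-global group G containing a Morse element, then the limit set of H in the Morse boundary equals the entire Morse boundary: Λ_*(H) = ∂_*G. -/

import Mathlib

open Classical

/-- Evaluation in `G` of a word over the alphabet `A`. -/
def wordEval {G : Type} [Group G] {A : Type} (π : A → G) (w : List A) : G :=
  (w.map π).prod

/-- `π : A → G` generates `G` (positive words suffice; the generating set is
assumed symmetric, see `SymmetricGen`). -/
def Generates {G : Type} [Group G] {A : Type} (π : A → G) : Prop :=
  ∀ g : G, ∃ w : List A, wordEval π w = g

/-- The generating set is symmetric: `A = A⁻¹`. -/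
def SymmetricGen {G : Type} [Group G] {A : Type} (π : A → G) : Prop :=
  ∀ a : A, ∃ b : A, π b = (π a)⁻¹

/-- The word length of `g` with respect to the generating map `π`. -/
noncomputable def wordLength {G : Type} [Group G] {A : Type} (π : A → G) (g : G) : ℕ :=
  sInf {n : ℕ | ∃ w : List A, w.length = n ∧ wordEval π w = g}

/-- The word metric on `G` induced by the generating map `π`. -/
noncomputable def wordDist {G : Type} [Group G] {A : Type} (π : A → G) (g h : G) : ℕ :=
  wordLength π (g⁻¹ * h)

/-- A Morse gauge: a function `M : (k, c) ↦ M(k,c)`. -/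
def MorseGauge : Type := ℝ → ℝ → ℝ

/-- `q : {0,…,n} → G` is a discrete `(k,c)`-quasi-geodesic in the Cayley
graph of `G` with respect to `π`. -/
noncomputable def IsDiscreteQG {G : Type} [Group G] {A : Type} (π : A → G)
    (k c : ℝ) (q : ℕ → G) (n : ℕ) : Prop :=
  ∀ i ≤ n, ∀ j ≤ n,
    (1 / k) * |(i : ℝ) - (j : ℝ)| - c ≤ (wordDist π (q i) (q j) : ℝ) ∧
    (wordDist π (q i) (q j) : ℝ) ≤ k * |(i : ℝ) - (j : ℝ)| + c

/-- `q : {0,…,n} → G` is a discrete geodesic in the Cayley graph. -/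
def IsDiscreteGeodesic {G : Type} [Group G] {A : Type} (π : A → G)
    (q : ℕ → G) (n : ℕ) : Prop :=
  ∀ i ≤ n, ∀ j ≤ n, wordDist π (q i) (q j) = Nat.dist i j

/-- The discrete path `q : {0,…,n} → G` is `M`-Morse: every discrete
`(k,c)`-quasi-geodesic with endpoints on `q` stays within `M k c` of the
subsegment of `q` between those endpoints. -/
def IsMorsePath {G : Type} [Group G] {A : Type} (π : A → G)
    (M : MorseGauge) (q : ℕ → G) (n : ℕ) : Prop :=
  ∀ k c : ℝ, 1 ≤ k → 0 ≤ c →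
    ∀ (p : ℕ → G) (m : ℕ), IsDiscreteQG π k c p m →
      ∀ i j : ℕ, i ≤ j → j ≤ n → p 0 = q i → p m = q j →
        ∀ l ≤ m, ∃ i' : ℕ, i ≤ i' ∧ i' ≤ j ∧ (wordDist π (p l) (q i') : ℝ) ≤ M k c

/-- The path in the Cayley graph labeled by the word `w`, starting at the
identity: `i ↦` the evaluation of the `i`-th prefix of `w`. -/
def wordPath {G : Type} [Group G] {A : Type} (π : A → G) (w : List A) (i : ℕ) : G :=
  wordEval π (w.take i)

/-- `w` is a geodesic word: its length realizes the word length of the element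
it represents. -/
def IsGeodesicWord {G : Type} [Group G] {A : Type} (π : A → G) (w : List A) : Prop :=
  w.length = wordLength π (wordEval π w)

/-- The path labeled by `w` is a `(B; M)`-local Morse geodesic: every subpath
of length at most `B` is an `M`-Morse (geodesic) path. -/
def IsLocalMorseWord {G : Type} [Group G] {A : Type} (π : A → G)
    (M : MorseGauge) (B : ℝ) (w : List A) : Prop :=
  ∀ i j : ℕ, i ≤ j → j ≤ w.length → (j : ℝ) - (i : ℝ) ≤ B →
    IsMorsePath π M (fun t => wordPath π w (i + t)) (j - i)

/-- `q : {0,…,n} → G` is a `(B; M; k, c)`-local Morse quasi-geodesic. -/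
noncomputable def IsLocalMorseQG {G : Type} [Group G] {A : Type} (π : A → G)
    (B : ℝ) (M : MorseGauge) (k c : ℝ) (q : ℕ → G) (n : ℕ) : Prop :=
  ∀ i j : ℕ, i ≤ j → j ≤ n → (j : ℝ) - (i : ℝ) ≤ B →
    IsDiscreteQG π k c (fun t => q (i + t)) (j - i) ∧
    IsMorsePath π M (fun t => q (i + t)) (j - i)

/-- The Cayley graph of `G` with respect to `π` has the Morse local-to-global
property: local Morse quasi-geodesics of sufficiently large local scale are
global Morse quasi-geodesics. -/
noncomputable def MorseLocalToGlobal {G : Type} [Group G] {A : Type} (π : A → G) : Prop :=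
  ∀ (M : MorseGauge) (k c : ℝ), 1 ≤ k → 0 ≤ c →
    ∃ (B : ℝ) (M' : MorseGauge) (k' c' : ℝ), 0 ≤ B ∧ 1 ≤ k' ∧ 0 ≤ c' ∧
      ∀ (q : ℕ → G) (n : ℕ), IsLocalMorseQG π B M k c q n →
        IsDiscreteQG π k' c' q n ∧ IsMorsePath π M' q n

/-- `H` is `(M,k)`-stable in the Cayley graph of `G` with respect to `π`:
every geodesic word from the identity to an element of `H` is `M`-Morse and
all its vertices lie within distance `k` of `H`. -/
def IsStable {G : Type} [Group G] {A : Type} (π : A → G)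
    (H : Subgroup G) (M : MorseGauge) (k : ℕ) : Prop :=
  ∀ h ∈ H, ∀ w : List A, wordEval π w = h → IsGeodesicWord π w →
    IsMorsePath π M (wordPath π w) w.length ∧
    ∀ i ≤ w.length, ∃ h' ∈ H, wordDist π (wordPath π w i) h' ≤ k

/-- A geodesic ray in the Cayley graph based at the identity. -/
def IsRay {G : Type} [Group G] {A : Type} (π : A → G) (γ : ℕ → G) : Prop :=
  γ 0 = 1 ∧ ∀ i j : ℕ, wordDist π (γ i) (γ j) = Nat.dist i j

/-- An `M`-Morse geodesic ray based at the identity. -/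
def IsMorseRay {G : Type} [Group G] {A : Type} (π : A → G)
    (M : MorseGauge) (γ : ℕ → G) : Prop :=
  IsRay π γ ∧ ∀ n : ℕ, IsMorsePath π M γ n

/-- Two rays are asymptotic if they stay at uniformly bounded distance. -/
def RayEquiv {G : Type} [Group G] {A : Type} (π : A → G) (γ δ : ℕ → G) : Prop :=
  ∃ C : ℕ, ∀ n : ℕ, wordDist π (γ n) (δ n) ≤ C

/-- The set of Morse geodesic rays based at the identity (any gauge). -/
def MorseRays {G : Type} [Group G] {A : Type} (π : A → G) : Type :=
  {γ : ℕ → G // ∃ M : MorseGauge, IsMorseRay π M γ}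

/-- The Morse boundary of `G` (with respect to `π`) as a set: Morse geodesic
rays based at the identity modulo asymptotic equivalence. -/
def MorseBoundary {G : Type} [Group G] {A : Type} (π : A → G) : Type :=
  Quot (fun γ δ : MorseRays π => RayEquiv π γ.1 δ.1)

/-- The boundary point determined by an `M`-Morse ray. -/
def mkBoundary {G : Type} [Group G] {A : Type} (π : A → G)
    (γ : ℕ → G) (M : MorseGauge) (h : IsMorseRay π M γ) : MorseBoundary π :=
  Quot.mk _ (⟨γ, M, h⟩ : MorseRays π)

/-- The stratum of `M`-Morse rays, carrying the compact-open topology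
(equivalently, the topology of pointwise convergence, `G` being discrete). -/
def stratumTop {G : Type} [Group G] {A : Type} (π : A → G) (M : MorseGauge) :
    TopologicalSpace {γ : ℕ → G // IsMorseRay π M γ} :=
  letI : TopologicalSpace G := ⊥
  inferInstance

/-- The Morse boundary carries the direct limit topology over the strata of
`M`-Morse rays. -/
noncomputable def boundaryTop {G : Type} [Group G] {A : Type} (π : A → G) :
    TopologicalSpace (MorseBoundary π) :=
  ⨆ M : MorseGauge,
    TopologicalSpace.coinduced
      (fun γ : {γ : ℕ → G // IsMorseRay π M γ} => mkBoundary π γ.1 M γ.2)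
      (stratumTop π M)

/-- The sequence of paths labeled by the geodesic words `w n` converges
uniformly on compact sets to the ray `γ`. -/
def ConvergesTo {G : Type} [Group G] {A : Type} (π : A → G)
    (w : ℕ → List A) (γ : ℕ → G) : Prop :=
  ∀ m : ℕ, ∃ N : ℕ, ∀ n ≥ N, m ≤ (w n).length ∧ ∀ t ≤ m, wordPath π (w n) t = γ t

/-- The limit set of a subgroup `H` in the Morse boundary: boundary points
represented by limits of uniformly Morse geodesics from the identity to
elements of `H`. -/
def limitSet {G : Type} [Group G] {A : Type} (π : A → G) (H : Subgroup G) :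
    Set (MorseBoundary π) :=
  {x | ∃ (M : MorseGauge) (γ : ℕ → G) (hγ : IsMorseRay π M γ),
    mkBoundary π γ M hγ = x ∧
    ∃ w : ℕ → List A,
      (∀ n : ℕ, IsGeodesicWord π (w n) ∧ wordEval π (w n) ∈ H ∧
        IsMorsePath π M (wordPath π (w n)) (w n).length) ∧
      ConvergesTo π w γ}

/-- `g` is a Morse element: the cyclic subgroup `⟨g⟩` is stable. -/
def IsMorseElement {G : Type} [Group G] {A : Type} (π : A → G) (g : G) : Prop :=
  ∃ (M : MorseGauge) (k : ℕ), IsStable π (Subgroup.zpowers g) M k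

/-- `x` is the attracting fixed point `g⁺` of `g`: `x` is represented by a
Morse ray which is the limit of geodesics from the identity to the powers
`g ^ n`. -/
def IsPlusPoint {G : Type} [Group G] {A : Type} (π : A → G)
    (g : G) (x : MorseBoundary π) : Prop :=
  ∃ (M : MorseGauge) (γ : ℕ → G) (hγ : IsMorseRay π M γ),
    mkBoundary π γ M hγ = x ∧
    ∃ w : ℕ → List A,
      (∀ n : ℕ, IsGeodesicWord π (w n) ∧ wordEval π (w n) = g ^ n) ∧
      ConvergesTo π w γ

/-- The generating assumptions. -/
def GS {G : Type} [Group G] {A : Type} (π : A → G) : Prop := Generates π ∧ SymmetricGen π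

/-- Real valued distance. -/
noncomputable abbrev dd {G : Type} [Group G] {A : Type} (π : A → G) (x y : G) : ℝ :=
  (wordDist π x y : ℝ)

section Basics
variable {G : Type} [Group G] {A : Type} {π : A → G}

theorem wordEval_append (w v : List A) :
    wordEval π (w ++ v) = wordEval π w * wordEval π v := by
  simp [wordEval]

theorem wl_le (w : List A) : wordLength π (wordEval π w) ≤ w.length :=
  Nat.sInf_le ⟨w, rfl, rfl⟩

theorem exists_geo_word (h : GS π) (g : G) :
    ∃ w : List A, w.length = wordLength π g ∧ wordEval π w = g := by
  have : (wordLength π g) ∈ {n : ℕ | ∃ w : List A, w.length = n ∧ wordEval π w = g} := by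
    apply Nat.sInf_mem
    obtain ⟨w, hw⟩ := h.1 g
    exact ⟨w.length, w, rfl, hw⟩
  exact this

theorem wl_one : wordLength π (1 : G) = 0 := by
  have := wl_le (π := π) []
  simpa [wordEval] using this

theorem wl_mul (h : GS π) (x y : G) :
    wordLength π (x * y) ≤ wordLength π x + wordLength π y := by
  obtain ⟨w, hw, rfl⟩ := exists_geo_word h x
  obtain ⟨v, hv, rfl⟩ := exists_geo_word h y
  rw [← wordEval_append, ← hw, ← hv]
  simpa using wl_le (π := π) (w ++ v)

theorem inv_word (h : GS π) (w : List A) :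
    ∃ v : List A, v.length = w.length ∧ wordEval π v = (wordEval π w)⁻¹ := by
  induction w with
  | nil => exact ⟨[], rfl, by simp [wordEval]⟩
  | cons a w ih =>
    obtain ⟨v, hv, hv'⟩ := ih
    obtain ⟨b, hb⟩ := h.2 a
    refine ⟨v ++ [b], by simp [hv], ?_⟩
    rw [wordEval_append, hv']
    simp [wordEval, hb]

theorem wl_inv_le (h : GS π) (x : G) : wordLength π x⁻¹ ≤ wordLength π x := by
  obtain ⟨w, hw, rfl⟩ := exists_geo_word h x
  obtain ⟨v, hv, hv'⟩ := inv_word h w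
  rw [← hv', ← hw, ← hv]
  exact wl_le v

theorem wl_inv (h : GS π) (x : G) : wordLength π x⁻¹ = wordLength π x :=
  le_antisymm (wl_inv_le h x) (by simpa using wl_inv_le h x⁻¹)

theorem wd_self (x : G) : wordDist π x x = 0 := by simp [wordDist, wl_one]

theorem wd_comm (h : GS π) (x y : G) : wordDist π x y = wordDist π y x := by
  unfold wordDist
  rw [← wl_inv h]; simp

theorem wd_tri (h : GS π) (x y z : G) :
    wordDist π x z ≤ wordDist π x y + wordDist π y z := by
  unfold wordDist
  have := wl_mul h (x⁻¹ * y) (y⁻¹ * z)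
  simpa [mul_assoc] using this

theorem wd_left (g x y : G) : wordDist π (g * x) (g * y) = wordDist π x y := by
  unfold wordDist; congr 1; group

theorem dd_self (x : G) : dd π x x = 0 := by simp [dd, wd_self]
theorem dd_comm (h : GS π) (x y : G) : dd π x y = dd π y x := by simp [dd, wd_comm h x y]
theorem dd_tri (h : GS π) (x y z : G) : dd π x z ≤ dd π x y + dd π y z := by
  exact_mod_cast wd_tri h x y z
theorem dd_left (g x y : G) : dd π (g * x) (g * y) = dd π x y := by simp [dd, wd_left]
theorem dd_nonneg (x y : G) : 0 ≤ dd π x y := Nat.cast_nonneg _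

theorem natdist_cast (i j : ℕ) : ((Nat.dist i j : ℕ) : ℝ) = |(i : ℝ) - j| := by
  rcases le_total i j with hij | hij
  · rw [Nat.dist_eq_sub_of_le hij, abs_sub_comm, abs_of_nonneg (by simpa using hij)]
    push_cast [hij]; ring
  · rw [Nat.dist_eq_sub_of_le_right hij, abs_of_nonneg (by simpa using hij)]
    push_cast [hij]; ring

theorem wordPath_len (w : List A) (i : ℕ) : wordLength π (wordPath π w i) ≤ i :=
  (wl_le _).trans (by simp)

theorem geo_word_path (h : GS π) (w : List A) (hw : IsGeodesicWord π w) :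
    IsDiscreteGeodesic π (wordPath π w) w.length := by
  have key : ∀ i j, i ≤ j → j ≤ w.length →
      wordDist π (wordPath π w i) (wordPath π w j) ≤ j - i := by
    intro i j hij hj
    have e : w.take j = w.take i ++ (w.take j).drop i := by
      conv_lhs => rw [← List.take_append_drop i (w.take j)]
      rw [List.take_take, min_eq_left hij]
    unfold wordDist wordPath
    rw [e, wordEval_append, inv_mul_cancel_left]
    refine (wl_le _).trans ?_
    simp [hj]
  have key2 : ∀ i j, i ≤ j → j ≤ w.length →
      wordDist π (wordPath π w i) (wordPath π w j) = j - i := by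
    intro i j hij hj
    apply le_antisymm (key i j hij hj)
    have h0 := key 0 i (Nat.zero_le _) (hij.trans hj)
    have h1 := key j w.length hj le_rfl
    have t1 := wd_tri h (wordPath π w 0) (wordPath π w i) (wordPath π w w.length)
    have t2 := wd_tri h (wordPath π w i) (wordPath π w j) (wordPath π w w.length)
    have e : wordDist π (wordPath π w 0) (wordPath π w w.length) = w.length := by
      unfold IsGeodesicWord at hw
      conv_rhs => rw [hw]
      simp [wordDist, wordPath, wordEval]
    omega
  intro i hi j hj
  rcases le_total i j with hij | hij
  · rw [key2 i j hij hj, Nat.dist_eq_sub_of_le hij]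
  · rw [wd_comm h, key2 j i hij hi, Nat.dist_eq_sub_of_le_right hij]

theorem exists_geodesic (h : GS π) (x y : G) :
    ∃ g : ℕ → G, g 0 = x ∧ g (wordDist π x y) = y ∧ IsDiscreteGeodesic π g (wordDist π x y) := by
  obtain ⟨w, hw, hw'⟩ := exists_geo_word h (x⁻¹ * y)
  have hg : IsGeodesicWord π w := by unfold IsGeodesicWord; rw [hw', hw]
  have := geo_word_path h w hg
  refine ⟨fun i => x * wordPath π w i, by simp [wordPath, wordEval], ?_, ?_⟩
  · have : wordDist π x y = w.length := by rw [hw]; rfl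
    simp [this, wordPath, hw']
  · have e : wordDist π x y = w.length := by rw [hw]; rfl
    rw [e]
    intro i hi j hj
    simp only [wd_left]
    exact this i hi j hj

theorem geo_dd {g : ℕ → G} {n : ℕ} (hg : IsDiscreteGeodesic π g n) {i j : ℕ} (hi : i ≤ n)
    (hj : j ≤ n) : dd π (g i) (g j) = |(i : ℝ) - j| := by
  rw [dd, hg i hi j hj, natdist_cast]

theorem geo_dd_le {g : ℕ → G} {n : ℕ} (hg : IsDiscreteGeodesic π g n) {i j : ℕ} (hij : i ≤ j)
    (hj : j ≤ n) : dd π (g i) (g j) = (j : ℝ) - i := by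
  rw [geo_dd hg (hij.trans hj) hj, abs_sub_comm, abs_of_nonneg]
  simpa using hij

theorem geo_qg {g : ℕ → G} {n : ℕ} (hg : IsDiscreteGeodesic π g n) : IsDiscreteQG π 1 0 g n := by
  intro i hi j hj
  have := geo_dd hg hi hj
  rw [dd] at this
  rw [this]; constructor <;> simp

theorem ray_geo {g : ℕ → G} (hg : IsRay π g) (n : ℕ) : IsDiscreteGeodesic π g n :=
  fun i _ j _ => hg.2 i j

theorem geo_sub {g : ℕ → G} {n : ℕ} (hg : IsDiscreteGeodesic π g n) {i j : ℕ} (hij : i ≤ j)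
    (hj : j ≤ n) : IsDiscreteGeodesic π (fun t => g (i + t)) (j - i) := by
  intro a ha b hb
  rw [hg (i + a) (by omega) (i + b) (by omega), Nat.dist_add_add_left]

theorem qg_mk (h : GS π) {k c : ℝ} {q : ℕ → G} {n : ℕ}
    (H : ∀ i j, i ≤ j → j ≤ n → (1 / k) * ((j : ℝ) - i) - c ≤ dd π (q i) (q j) ∧
      dd π (q i) (q j) ≤ k * ((j : ℝ) - i) + c) : IsDiscreteQG π k c q n := by
  intro i hi j hj
  rcases le_total i j with hij | hij
  · have := H i j hij hj
    rw [abs_sub_comm, abs_of_nonneg (by simpa using hij)]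
    exact this
  · have := H j i hij hi
    rw [abs_of_nonneg (by simpa using hij), wd_comm h]
    exact this

theorem qg_le {k c : ℝ} {q : ℕ → G} {n : ℕ} (H : IsDiscreteQG π k c q n) {i j : ℕ}
    (hij : i ≤ j) (hj : j ≤ n) : (1 / k) * ((j : ℝ) - i) - c ≤ dd π (q i) (q j) ∧
      dd π (q i) (q j) ≤ k * ((j : ℝ) - i) + c := by
  have := H i (hij.trans hj) j hj
  rw [abs_sub_comm, abs_of_nonneg (by simpa using hij)] at this
  exact this

theorem qg_mono {k c k' c' : ℝ} {q : ℕ → G} {n : ℕ} (hk : 1 ≤ k) (hkk : k ≤ k') (hcc : c ≤ c')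
    (H : IsDiscreteQG π k c q n) : IsDiscreteQG π k' c' q n := by
  intro i hi j hj
  obtain ⟨h1, h2⟩ := H i hi j hj
  have hx := abs_nonneg ((i : ℝ) - j)
  have e : 1 / k' ≤ 1 / k := one_div_le_one_div_of_le (by linarith) hkk
  constructor
  · have := mul_le_mul_of_nonneg_right e hx
    linarith
  · have := mul_le_mul_of_nonneg_right hkk hx
    linarith

theorem qg_rev {k c : ℝ} {q : ℕ → G} {n : ℕ}
    (H : IsDiscreteQG π k c q n) : IsDiscreteQG π k c (fun i => q (n - i)) n := by
  intro i hi j hj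
  have := H (n - i) (by omega) (n - j) (by omega)
  have e : |((n - i : ℕ) : ℝ) - ((n - j : ℕ) : ℝ)| = |(i : ℝ) - j| := by
    rw [Nat.cast_sub hi, Nat.cast_sub hj, abs_sub_comm]; congr 1; ring
  rw [e] at this
  exact this

theorem qg_close (h : GS π) {k c δ : ℝ} {p p' : ℕ → G} {n : ℕ} (H : IsDiscreteQG π k c p n)
    (hc : ∀ i ≤ n, dd π (p i) (p' i) ≤ δ) : IsDiscreteQG π k (c + 2 * δ) p' n := by
  intro i hi j hj
  obtain ⟨h1, h2⟩ := H i hi j hj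
  have a1 := hc i hi
  have a2 := hc j hj
  have t1 := dd_tri h (p i) (p' i) (p j)
  have t2 := dd_tri h (p' i) (p' j) (p j)
  have t3 := dd_tri h (p' i) (p i) (p' j)
  have t4 := dd_tri h (p i) (p j) (p' j)
  rw [dd_comm h (p' i) (p i)] at t3
  rw [dd_comm h (p' j) (p j)] at t2
  constructor <;> linarith

theorem qg_left {k c : ℝ} {p : ℕ → G} {n : ℕ} (g : G) (H : IsDiscreteQG π k c p n) :
    IsDiscreteQG π k c (fun i => g * p i) n := by
  intro i hi j hj
  simp only [wd_left]
  exact H i hi j hj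

theorem qg_congr {k c : ℝ} {p p' : ℕ → G} {n : ℕ} (e : ∀ i ≤ n, p i = p' i)
    (H : IsDiscreteQG π k c p n) : IsDiscreteQG π k c p' n := by
  intro i hi j hj
  rw [← e i hi, ← e j hj]
  exact H i hi j hj

theorem morse_congr {M : MorseGauge} {p p' : ℕ → G} {n : ℕ} (e : ∀ i ≤ n, p i = p' i)
    (H : IsMorsePath π M p n) : IsMorsePath π M p' n := by
  intro k c hk hc r m hr i j hij hj h0 hm l hl
  rw [← e i (hij.trans hj)] at h0
  rw [← e j hj] at hm
  obtain ⟨i', h1, h2, h3⟩ := H k c hk hc r m hr i j hij hj h0 hm l hl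
  refine ⟨i', h1, h2, ?_⟩
  rwa [← e i' (h2.trans hj)]

theorem morse_left {M : MorseGauge} {p : ℕ → G} {n : ℕ} (g : G)
    (H : IsMorsePath π M p n) : IsMorsePath π M (fun i => g * p i) n := by
  intro k c hk hc r m hr i j hij hj h0 hm l hl
  obtain ⟨i', h1, h2, h3⟩ := H k c hk hc (fun i => g⁻¹ * r i) m (qg_left _ hr) i j hij hj
    (by simp [h0]) (by simp [hm]) l hl
  refine ⟨i', h1, h2, ?_⟩
  have := wd_left (π := π) g (g⁻¹ * r l) (p i')
  rw [mul_inv_cancel_left] at this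
  rwa [this]

theorem morse_rev {M : MorseGauge} {q : ℕ → G} {n : ℕ}
    (H : IsMorsePath π M q n) : IsMorsePath π M (fun i => q (n - i)) n := by
  intro k c hk hc r m hr i j hij hj h0 hm l hl
  obtain ⟨i', h1, h2, h3⟩ := H k c hk hc _ m (qg_rev hr) (n - j) (n - i) (by omega) (by omega)
    (by simpa using hm) (by simpa using h0) (m - l) (by omega)
  refine ⟨n - i', by omega, by omega, ?_⟩
  have e1 : m - (m - l) = l := by omega
  have e2 : n - (n - i') = i' := by omega
  simp only [e1] at h3
  simpa only [e2] using h3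

theorem morse_sub {M : MorseGauge} {q : ℕ → G} {n a b : ℕ} (hab : a ≤ b) (hb : b ≤ n)
    (H : IsMorsePath π M q n) : IsMorsePath π M (fun i => q (a + i)) (b - a) := by
  intro k c hk hc r m hr i j hij hj h0 hm l hl
  obtain ⟨i', h1, h2, h3⟩ := H k c hk hc r m hr (a + i) (a + j) (by omega) (by omega)
    h0 hm l hl
  refine ⟨i' - a, by omega, by omega, ?_⟩
  have e1 : a + (i' - a) = i' := by omega
  simpa only [e1] using h3

theorem morse_mono {M M' : MorseGauge} {q : ℕ → G} {n : ℕ}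
    (hM : ∀ k c, M k c ≤ M' k c) (H : IsMorsePath π M q n) : IsMorsePath π M' q n := by
  intro k c hk hc r m hr i j hij hj h0 hm l hl
  obtain ⟨i', h1, h2, h3⟩ := H k c hk hc r m hr i j hij hj h0 hm l hl
  exact ⟨i', h1, h2, h3.trans (hM k c)⟩

theorem qg_sub {k c : ℝ} {q : ℕ → G} {n a b : ℕ} (hab : a ≤ b) (hb : b ≤ n)
    (H : IsDiscreteQG π k c q n) : IsDiscreteQG π k c (fun i => q (a + i)) (b - a) := by
  intro i hi j hj
  have := H (a + i) (by omega) (a + j) (by omega)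
  push_cast at this
  rw [add_sub_add_left_eq_sub] at this
  exact this

/-- The bound in `near`. -/
noncomputable def Nb (M : MorseGauge) (k c δ : ℝ) : ℝ := max (M k (c + 2 * δ)) 0 + δ

theorem Nb_nonneg (M : MorseGauge) (k c : ℝ) {δ : ℝ} (hδ : 0 ≤ δ) : 0 ≤ Nb M k c δ :=
  add_nonneg (le_max_right _ _) hδ

/-- Quasi-geodesics with endpoints near a Morse path are near the path. -/
theorem near (h : GS π) {M : MorseGauge} {q : ℕ → G} {n : ℕ} (H : IsMorsePath π M q n)
    {k c δ : ℝ} (hk : 1 ≤ k) (hc : 0 ≤ c) (hδ : 0 ≤ δ) {p : ℕ → G} {m : ℕ}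
    (hp : IsDiscreteQG π k c p m) {i j : ℕ} (hi : i ≤ n) (hj : j ≤ n)
    (h0 : dd π (p 0) (q i) ≤ δ) (hm : dd π (p m) (q j) ≤ δ) :
    ∀ l ≤ m, ∃ x, min i j ≤ x ∧ x ≤ max i j ∧ dd π (p l) (q x) ≤ Nb M k c δ := by
  have main : ∀ (p : ℕ → G) (i j : ℕ), IsDiscreteQG π k c p m → i ≤ j → j ≤ n →
      dd π (p 0) (q i) ≤ δ → dd π (p m) (q j) ≤ δ →
      ∀ l ≤ m, ∃ x, i ≤ x ∧ x ≤ j ∧ dd π (p l) (q x) ≤ Nb M k c δ := by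
    intro p i j hp hij hj h0 hm l hl
    by_cases hm0 : m = 0
    · obtain rfl : l = 0 := by omega
      refine ⟨i, le_rfl, hij, h0.trans ?_⟩
      unfold Nb
      have := le_max_right (M k (c + 2 * δ)) 0
      linarith
    set p' : ℕ → G := fun t => if t = 0 then q i else if t = m then q j else p t with hp'
    have hcl : ∀ t ≤ m, dd π (p t) (p' t) ≤ δ := by
      intro t ht
      simp only [hp']
      split_ifs with h1 h2
      · rw [h1]; exact h0
      · rw [h2]; exact hm
      · rw [dd_self]; exact hδ
    have hq := qg_close h hp hcl
    obtain ⟨x, h1, h2, h3⟩ := H k (c + 2 * δ) hk (by linarith) p' m hq i j hij hj (by simp [hp'])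
      (by
        simp [hp', hm0]) l hl
    refine ⟨x, h1, h2, ?_⟩
    have := dd_tri h (p l) (p' l) (q x)
    have := hcl l hl
    have := le_max_left (M k (c + 2 * δ)) 0
    unfold Nb
    linarith
  intro l hl
  rcases le_total i j with hij | hij
  · rw [min_eq_left hij, max_eq_right hij]
    exact main p i j hp hij hj h0 hm l hl
  · rw [min_eq_right hij, max_eq_left hij]
    obtain ⟨x, h1, h2, h3⟩ := main _ j i (qg_rev hp) hij hi (by simpa using hm) (by simpa using h0) (m - l) (by omega)
    refine ⟨x, h1, h2, ?_⟩
    have e1 : m - (m - l) = l := by omega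
    simpa only [e1] using h3

end Basics
section Proj
variable {G : Type} [Group G] {A : Type} {π : A → G}

theorem projQG (h : GS π) {k c : ℝ} (hk : 1 ≤ k) (hc : 0 ≤ c) {p : ℕ → G} {m : ℕ}
    (hp : IsDiscreteQG π k c p m) {x : G} {a : ℕ} (ha : a ≤ m)
    (hmin : ∀ i ≤ a, dd π (p a) x ≤ dd π (p i) x) {σ : ℕ → G} {L : ℕ}
    (hσ : IsDiscreteGeodesic π σ L) (hσ0 : σ 0 = p a) (hσL : σ L = x) :
    IsDiscreteQG π (3 * k) c (fun t => if t ≤ a then p t else σ (t - a)) (a + L) := by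
  have hk0 : 0 < k := by linarith
  have hκ : 1 / (3 * k) = (1 / k) / 3 := by field_simp
  have hκ1 : 1 / k ≤ 1 := by rw [div_le_one hk0]; exact hk
  have hκ0 : 0 < 1 / k := by positivity
  apply qg_mk h
  rw [hκ]
  generalize hK : 1 / k = κ at *
  intro i j hij hj
  by_cases hja : j ≤ a
  · have hia : i ≤ a := hij.trans hja
    simp only [hja, hia, if_true]
    have := qg_le hp hij (hja.trans ha)
    rw [hK] at this
    have h0 : (0 : ℝ) ≤ (j : ℝ) - i := by simpa using hij
    constructor
    · nlinarith
    · nlinarith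
  · by_cases hia : i ≤ a
    · simp only [hja, hia, if_true, if_false]
      have hpa := qg_le hp hia ha
      rw [hK] at hpa
      obtain ⟨b, rfl⟩ : ∃ b, j = a + b := ⟨j - a, by omega⟩
      have hb : b ≤ L := by omega
      rw [Nat.add_sub_cancel_left]
      have s1 := geo_dd_le hσ (Nat.zero_le b) hb
      have s2 := geo_dd_le hσ hb le_rfl
      have s3 := geo_dd_le hσ (Nat.zero_le L) le_rfl
      rw [hσ0] at s1 s3
      rw [hσL] at s2 s3
      have m1 := hmin i hia
      have t1 := dd_tri h (p i) (σ b) x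
      have t2 := dd_tri h (p i) (σ b) (p a)
      have t3 := dd_tri h (p i) (p a) (σ b)
      rw [dd_comm h (σ b)] at t2
      have hia' : (0 : ℝ) ≤ (a : ℝ) - i := by simpa using hia
      have hb0 : (0 : ℝ) ≤ b := Nat.cast_nonneg b
      push_cast at *
      have e1 : κ * b ≤ b := by nlinarith
      constructor
      · nlinarith
      · nlinarith
    · simp only [hja, hia, if_false]
      have s := geo_dd_le hσ (i := i - a) (j := j - a) (by omega) (by omega)
      have e : (((j - a : ℕ) : ℝ)) - ((i - a : ℕ) : ℝ) = (j : ℝ) - i := by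
        rw [Nat.cast_sub (by omega), Nat.cast_sub (by omega)]; ring
      rw [e] at s
      rw [s]
      have h0 : (0 : ℝ) ≤ (j : ℝ) - i := by simpa using hij
      constructor
      · nlinarith
      · nlinarith

/-- A quasi-geodesic starting near a Morse path is near the path up to the nearest point
projection of another point near the path. -/
theorem nearProj (h : GS π) {M : MorseGauge} {q : ℕ → G} {n : ℕ} (H : IsMorsePath π M q n)
    {k c δ : ℝ} (hk : 1 ≤ k) (hc : 0 ≤ c) (hδ : 0 ≤ δ) {p : ℕ → G} {m : ℕ}
    (hp : IsDiscreteQG π k c p m) {x : G} {a : ℕ} (ha : a ≤ m)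
    (hmin : ∀ i ≤ a, dd π (p a) x ≤ dd π (p i) x) {i j : ℕ} (hi : i ≤ n) (hj : j ≤ n)
    (h0 : dd π (p 0) (q i) ≤ δ) (hm : dd π x (q j) ≤ δ) :
    ∀ l ≤ a, ∃ y, min i j ≤ y ∧ y ≤ max i j ∧ dd π (p l) (q y) ≤ Nb M (3 * k) c δ := by
  intro l hl
  obtain ⟨σ, s0, s1, hσ⟩ := exists_geodesic h (p a) x
  have hQ := projQG h hk hc hp ha hmin hσ s0 s1
  obtain ⟨y, h1, h2, h3⟩ := near h H (by linarith) hc hδ hQ hi hj (by simpa using h0)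
    (by
      split_ifs with hh
      · have : wordDist π (p a) x = 0 := by omega
        rw [this] at s1
        rw [this, add_zero, ← s0, s1]; exact hm
      · rw [Nat.add_sub_cancel_left, s1]; exact hm) l (by omega)
  refine ⟨y, h1, h2, ?_⟩
  simpa [hl] using h3

theorem exists_argmin (f : ℕ → ℝ) (m : ℕ) : ∃ a ≤ m, ∀ i ≤ m, f a ≤ f i := by
  obtain ⟨a, ha, h⟩ := Finset.exists_min_image (Finset.range (m + 1)) f ⟨0, by simp⟩
  exact ⟨a, by simpa [Nat.lt_succ_iff] using ha, fun i hi => h i (by simpa [Nat.lt_succ_iff] using hi)⟩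

/-- Every point of a Morse quasi-geodesic is near a geodesic with nearby endpoints. -/
theorem conv (h : GS π) {M : MorseGauge} {q : ℕ → G} {n : ℕ} (H : IsMorsePath π M q n)
    {k c δ : ℝ} (hk : 1 ≤ k) (hc : 0 ≤ c) (hδ : 0 ≤ δ) (hq : IsDiscreteQG π k c q n)
    {g : ℕ → G} {L : ℕ} (hg : IsDiscreteGeodesic π g L) {a b : ℕ} (ha : a ≤ n) (hb : b ≤ n)
    (h0 : dd π (g 0) (q a) ≤ δ) (hL : dd π (g L) (q b) ≤ δ) :
    ∀ l, min a b ≤ l → l ≤ max a b → ∃ i ≤ L, dd π (q l) (g i) ≤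
      k * (k * (2 * Nb M 1 0 δ + δ + 1 + c)) + c + Nb M 1 0 δ := by
  set D := Nb M 1 0 δ with hD
  have hD0 : 0 ≤ D := Nb_nonneg _ _ _ hδ
  have hk0 : 0 < k := by linarith
  have inv : ∀ x y : ℝ, (1 / k) * x - c ≤ y → x ≤ k * (y + c) := by
    intro x y hxy
    have : k * ((1 / k) * x) ≤ k * (y + c) := by
      apply mul_le_mul_of_nonneg_left _ hk0.le; linarith
    rwa [← mul_assoc, mul_one_div_cancel hk0.ne', one_mul] at this
  have main : ∀ (g : ℕ → G) (a b : ℕ), IsDiscreteGeodesic π g L → a ≤ b → b ≤ n →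
      dd π (g 0) (q a) ≤ δ → dd π (g L) (q b) ≤ δ →
      ∀ l, a ≤ l → l ≤ b → ∃ i ≤ L, dd π (q l) (g i) ≤
      k * (k * (2 * D + δ + 1 + c)) + c + D := by
    intro g a b hg hab hb h0 hL l hal hlb
    have hne : ∀ i ≤ L, ∃ x, a ≤ x ∧ x ≤ b ∧ dd π (g i) (q x) ≤ D := by
      have := near h H le_rfl le_rfl hδ (geo_qg hg) (hab.trans hb) hb h0 hL
      rw [min_eq_left hab, max_eq_right hab] at this
      exact this
    have hδD : δ ≤ D := by
      rw [hD]; unfold Nb; have := le_max_right (M 1 (0 + 2 * δ)) 0; linarith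
    -- two indices around l with close images
    have fin : ∀ x y i, i ≤ L → x ≤ l → l ≤ y → y ≤ n → dd π (g i) (q x) ≤ D →
        dd π (q x) (q y) ≤ 2 * D + δ + 1 → ∃ i ≤ L, dd π (q l) (g i) ≤
      k * (k * (2 * D + δ + 1 + c)) + c + D := by
      intro x y i hi hxl hly hyn hgx hxy
      refine ⟨i, hi, ?_⟩
      have e1 := inv _ _ ((qg_le hq (hxl.trans hly) hyn).1)
      have e2 := (qg_le hq hxl (hly.trans hyn)).2
      have e3 : (l : ℝ) ≤ y := by exact_mod_cast hly
      have e4 : (y : ℝ) - x ≤ k * (2 * D + δ + 1 + c) := by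
        refine e1.trans (mul_le_mul_of_nonneg_left (by linarith) hk0.le)
      have e5 : k * ((l : ℝ) - x) ≤ k * (k * (2 * D + δ + 1 + c)) :=
        mul_le_mul_of_nonneg_left (by linarith) hk0.le
      have t := dd_tri h (q l) (q x) (g i)
      rw [dd_comm h (q l) (q x), dd_comm h (q x) (g i)] at t
      linarith
    let P : ℕ → Prop := fun i => ∃ x, a ≤ x ∧ x ≤ l ∧ dd π (g i) (q x) ≤ D
    have hP0 : P 0 := ⟨a, le_rfl, hal, h0.trans hδD⟩
    by_cases hPL : P L
    · obtain ⟨x, hx1, hx2, hx3⟩ := hPL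
      refine fin x b L le_rfl hx2 hlb hb hx3 ?_
      have t := dd_tri h (q x) (g L) (q b)
      rw [dd_comm h (q x) (g L)] at t
      linarith
    · have : ∃ i, i < L ∧ P i ∧ ¬ P (i + 1) := by
        by_contra hcon
        push Not at hcon
        have : ∀ i ≤ L, P i := by
          intro i
          induction i with
          | zero => intro _; exact hP0
          | succ i ih => intro hi; exact hcon i (by omega) (ih (by omega))
        exact hPL (this L le_rfl)
      obtain ⟨i, hiL, ⟨x, hx1, hx2, hx3⟩, hn⟩ := this
      obtain ⟨y, hy1, hy2, hy3⟩ := hne (i + 1) (by omega)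
      have hly : l ≤ y := by
        by_contra hc
        exact hn ⟨y, hy1, by omega, hy3⟩
      refine fin x y i hiL.le hx2 hly (hy2.trans hb) hx3 ?_
      have t := dd_tri h (q x) (g i) (q y)
      have t2 := dd_tri h (g i) (g (i + 1)) (q y)
      rw [dd_comm h (q x) (g i)] at t
      have := geo_dd_le hg (Nat.le_succ i) hiL
      push_cast at this
      simp only [Nat.succ_eq_add_one] at this
      linarith
  intro l hl1 hl2
  rcases le_total a b with hab | hab
  · rw [min_eq_left hab] at hl1
    rw [max_eq_right hab] at hl2
    exact main g a b hg hab hb h0 hL l hl1 hl2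
  · rw [min_eq_right hab] at hl1
    rw [max_eq_left hab] at hl2
    have hg' : IsDiscreteGeodesic π (fun i => g (L - i)) L := by
      intro i hi j hj
      rw [hg _ (by omega) _ (by omega)]
      simp only [Nat.dist]; omega
    obtain ⟨i, hi, h3⟩ := main (fun i => g (L - i)) b a hg' hab ha (by simpa using hL)
      (by simpa using h0) l hl1 hl2
    exact ⟨L - i, by omega, h3⟩

/-- bound of `conv` -/
noncomputable def Cb (M : MorseGauge) (k c δ : ℝ) : ℝ :=
  k * (k * (2 * Nb M 1 0 δ + δ + 1 + c)) + c + Nb M 1 0 δ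

/-- A geodesic with the same endpoints as a Morse quasi-geodesic is Morse. -/
theorem geo_morse (h : GS π) (M : MorseGauge) (k c : ℝ) (hk : 1 ≤ k) (hc : 0 ≤ c) :
    ∃ M2 : MorseGauge, ∀ (q : ℕ → G) (n : ℕ), IsMorsePath π M q n → IsDiscreteQG π k c q n →
      ∀ (g : ℕ → G) (L : ℕ), IsDiscreteGeodesic π g L → g 0 = q 0 → g L = q n →
        IsMorsePath π M2 g L := by
  set δ := Nb M 1 0 0 with hδ
  have hδ0 : 0 ≤ δ := Nb_nonneg _ _ _ le_rfl
  refine ⟨fun k' c' => Nb M k' c' δ + Cb M k c δ, ?_⟩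
  intro q n hM hq g L hg h0 hL k' c' hk' hc' p m hp i j hij hj hp0 hpm l hl
  have hn := near h hM le_rfl le_rfl le_rfl (geo_qg hg) (Nat.zero_le n) le_rfl
    (by rw [h0, dd_self]) (by rw [hL, dd_self])
  obtain ⟨a, -, ha, ha'⟩ := hn i (hij.trans hj)
  obtain ⟨b, -, hb, hb'⟩ := hn j hj
  rw [max_eq_right (Nat.zero_le n)] at ha hb
  obtain ⟨x, hx1, hx2, hx3⟩ := near h hM hk' hc' hδ0 hp ha hb (by rw [hp0]; exact ha')
    (by rw [hpm]; exact hb') l hl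
  obtain ⟨y, hy, hy'⟩ := conv h hM hk hc hδ0 hq (geo_sub hg hij hj) ha hb ha'
    (by rw [Nat.add_sub_cancel' hij]; exact hb') x hx1 hx2
  refine ⟨i + y, by omega, by omega, ?_⟩
  have t := dd_tri h (p l) (q x) (g (i + y))
  unfold Cb
  linarith

end Proj
section Rays
variable {G : Type} [Group G] {A : Type} {π : A → G}

/-- `z` fixes the endpoint of `α`. -/
def Asy (π : A → G) (α : ℕ → G) (z : G) : Prop := ∃ C : ℝ, ∀ t, dd π (z * α t) (α t) ≤ C

theorem ray_dd {α : ℕ → G} (hα : IsRay π α) (s t : ℕ) : dd π (α s) (α t) = |(s : ℝ) - t| :=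
  geo_dd (ray_geo hα (max s t)) (le_max_left _ _) (le_max_right _ _)

theorem ray_dd0 {α : ℕ → G} (hα : IsRay π α) (t : ℕ) : dd π 1 (α t) = t := by
  rw [← hα.1, ray_dd hα]; simp

theorem ray_ddz {α : ℕ → G} (hα : IsRay π α) (z : G) (t : ℕ) : dd π z (z * α t) = t := by
  have := dd_left (π := π) z 1 (α t)
  rw [mul_one] at this
  rw [this, ray_dd0 hα]

theorem nonasym_bound (h : GS π) {M : MorseGauge} {α : ℕ → G} (hα : IsRay π α)
    (hM : ∀ n, IsMorsePath π M α n) {z : G} (hz : ¬ Asy π α z) (D : ℝ) :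
    ∃ S : ℝ, ∀ u v : ℕ, dd π (α u) (z * α v) ≤ D → (u : ℝ) ≤ S := by
  by_contra hcon
  push Not at hcon
  apply hz
  set δ := max (dd π 1 z) D with hδ
  have hδ0 : 0 ≤ δ := (dd_nonneg _ _).trans (le_max_left _ _)
  refine ⟨2 * Nb M 1 0 δ + dd π 1 z, fun t => ?_⟩
  obtain ⟨u, v, h1, h2⟩ := hcon t
  have h2' : t ≤ u := by exact_mod_cast h2.le
  obtain ⟨x, -, -, hx⟩ := near h (morse_left z (hM v)) le_rfl le_rfl hδ0
    (geo_qg (ray_geo hα u)) (Nat.zero_le v) le_rfl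
    (by rw [hα.1, mul_one]; exact le_max_left _ _) (h1.trans (le_max_right _ _)) t h2'
  have a1 := ray_dd0 hα t
  have a2 := ray_ddz hα z x
  have t1 := dd_tri h 1 z (α t)
  have t2 := dd_tri h z (z * α x) (α t)
  have t3 := dd_tri h z 1 (z * α x)
  have t4 := dd_tri h 1 (α t) (z * α x)
  have t5 := dd_tri h (z * α t) (z * α x) (α t)
  rw [dd_left, ray_dd hα] at t5
  rw [dd_comm h z 1] at t3
  rw [dd_comm h (z * α x) (α t)] at t2 t5
  have : |(t : ℝ) - x| ≤ Nb M 1 0 δ + dd π 1 z := by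
    rw [abs_le]; constructor <;> linarith
  linarith

theorem nonasym_dist (h : GS π) {M : MorseGauge} {α : ℕ → G} (hα : IsRay π α)
    (hM : ∀ n, IsMorsePath π M α n) {z : G} (hz : ¬ Asy π α z) :
    ∃ C : ℝ, 0 ≤ C ∧ ∀ s t : ℕ, (s : ℝ) + t - C ≤ dd π (α s) (z * α t) := by
  set δ := dd π 1 z with hδ
  have hδ0 : 0 ≤ δ := dd_nonneg _ _
  set D1 := Nb M (3 * 1) 0 0 with hD1
  have hD10 : 0 ≤ D1 := Nb_nonneg _ _ _ le_rfl
  set D2 := Nb M (3 * 1) 0 δ with hD2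
  have hD20 : 0 ≤ D2 := Nb_nonneg _ _ _ hδ0
  obtain ⟨S, hS⟩ := nonasym_bound h hα hM hz (D1 + D2)
  refine ⟨2 * (max S 0 + D1) + δ, by have := le_max_right S 0; linarith, fun s t => ?_⟩
  obtain ⟨ρ, r0, r1, hρ⟩ := exists_geodesic h (α s) (z * α t)
  set N := wordDist π (α s) (z * α t) with hN
  obtain ⟨a, ha, hmin⟩ := exists_argmin (fun i => dd π (ρ i) 1) N
  obtain ⟨u, -, -, hu⟩ := nearProj h (hM s) le_rfl le_rfl le_rfl (geo_qg hρ) ha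
    (fun i hi => hmin i (hi.trans ha)) (i := s) (j := 0) le_rfl (Nat.zero_le s)
    (by rw [r0, dd_self]) (by rw [hα.1, dd_self]) a le_rfl
  obtain ⟨v, -, -, hv⟩ := nearProj h (morse_left z (hM t)) le_rfl le_rfl hδ0
    (qg_rev (geo_qg hρ)) (x := 1) (a := N - a) (by omega)
    (fun i hi => by
      have e : N - (N - a) = a := by omega
      simp only [e]
      exact hmin _ (by omega)) (i := t) (j := 0) le_rfl (Nat.zero_le t)
    (by simp only [Nat.sub_zero]; rw [r1, dd_self]; exact hδ0) (by rw [hα.1, mul_one])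
    (N - a) le_rfl
  have e : N - (N - a) = a := by omega
  simp only [e] at hv
  have huv := dd_tri h (α u) (ρ a) (z * α v)
  rw [dd_comm h (α u) (ρ a)] at huv
  have hS' := hS u v (by linarith)
  have b0 := ray_dd0 hα u
  have b1 := dd_tri h 1 (α u) (ρ a)
  rw [dd_comm h (α u) (ρ a)] at b1
  have b2 := ray_dd0 hα s
  have b3 := ray_ddz hα z t
  have b4 := geo_dd_le hρ (Nat.zero_le a) ha
  have b5 := geo_dd_le hρ ha le_rfl
  rw [r0] at b4
  rw [r1] at b5
  have b6 := dd_tri h 1 (ρ a) (α s)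
  rw [dd_comm h (ρ a)] at b6
  have b7 := dd_tri h z 1 (z * α t)
  rw [dd_comm h z 1] at b7
  have b8 := dd_tri h 1 (ρ a) (z * α t)
  have b9 := le_max_left S 0
  have b10 : dd π (α s) (z * α t) = N := by rw [dd, hN]
  push_cast at *
  linarith

/-- Uniform closeness for elements fixing the endpoint. -/
theorem asym_close (h : GS π) {M : MorseGauge} {α : ℕ → G} (hα : IsRay π α)
    (hM : ∀ n, IsMorsePath π M α n) {z : G} (hz : Asy π α z) :
    ∃ T : ℕ, ∀ τ ≥ T, ∃ u : ℕ, dd π (z * α u) (α τ) ≤ 3 * Nb M (3 * 1) 0 0 := by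
  obtain ⟨C, hC⟩ := hz
  set D1 := Nb M (3 * 1) 0 0 with hD1
  obtain ⟨C', hC'⟩ := exists_nat_ge C
  set Z := wordDist π 1 z with hZ
  refine ⟨2 * Z, fun τ hτ => ?_⟩
  set n := τ + 2 * C' + Z with hn
  obtain ⟨ρ, r0, r1, hρ⟩ := exists_geodesic h 1 (z * α n)
  set N := wordDist π 1 (z * α n) with hN
  have hdN : dd π 1 (z * α n) = N := by rw [dd, hN]
  have hdZ : dd π 1 z = Z := by rw [dd, hZ]
  have hNn : (n : ℝ) ≤ N + Z := by
    have b7 := dd_tri h z 1 (z * α n)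
    rw [dd_comm h z 1, ray_ddz hα] at b7
    linarith
  have hNn' : n ≤ N + Z := by exact_mod_cast hNn
  obtain ⟨a, ha, hmin⟩ := exists_argmin (fun i => dd π (ρ i) (α n)) N
  have haN : N ≤ a + 2 * C' := by
    have b1 := geo_dd_le hρ ha le_rfl
    rw [r1] at b1
    have b2 := hmin N le_rfl
    simp only [r1] at b2
    have b3 := dd_tri h (ρ a) (α n) (z * α n)
    rw [dd_comm h (α n)] at b3
    have b4 := hC n
    have : (N : ℝ) ≤ a + 2 * C' := by linarith
    exact_mod_cast this
  obtain ⟨v, -, -, hv⟩ := nearProj h (hM n) le_rfl le_rfl le_rfl (geo_qg hρ) ha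
    (fun i hi => hmin i (hi.trans ha)) (i := 0) (j := n) (Nat.zero_le n) le_rfl
    (by rw [r0, hα.1, dd_self]) (by rw [dd_self]) τ (by omega)
  obtain ⟨a', ha', hmin'⟩ := exists_argmin (fun i => dd π (ρ (N - i)) z) N
  have haN' : N ≤ a' + 2 * Z := by
    have b1 := geo_dd_le hρ (Nat.zero_le (N - a')) (by omega)
    rw [r0, Nat.cast_sub ha'] at b1
    have b2 := hmin' N le_rfl
    simp only [Nat.sub_self, r0] at b2
    have b3 := dd_tri h 1 z (ρ (N - a'))
    rw [dd_comm h z] at b3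
    have : (N : ℝ) ≤ a' + 2 * Z := by push_cast at *; linarith
    exact_mod_cast this
  obtain ⟨u, -, -, hu⟩ := nearProj h (morse_left z (hM n)) le_rfl le_rfl le_rfl
    (qg_rev (geo_qg hρ)) (x := z) ha'
    (fun i hi => hmin' i (hi.trans ha')) (i := n) (j := 0) le_rfl (Nat.zero_le n)
    (by simp only [Nat.sub_zero]; rw [r1, dd_self]) (by rw [hα.1, mul_one, dd_self]) (N - τ)
    (by omega)
  have e : N - (N - τ) = τ := by omega
  simp only [e] at hu
  refine ⟨u, ?_⟩
  have c1 := geo_dd_le hρ (Nat.zero_le τ) (by omega)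
  rw [r0] at c1
  have c2 := ray_dd0 hα v
  have c3 := dd_tri h 1 (α v) (ρ τ)
  have c4 := dd_tri h 1 (ρ τ) (α v)
  rw [dd_comm h (α v)] at c3
  have c5 : |(v : ℝ) - τ| ≤ D1 := by
    push_cast at *
    rw [abs_le]; constructor <;> linarith
  have c6 := dd_tri h (z * α u) (ρ τ) (α τ)
  have c7 := dd_tri h (ρ τ) (α v) (α τ)
  rw [ray_dd hα v τ] at c7
  rw [dd_comm h (z * α u) (ρ τ)] at c6
  linarith

/-- glueing two rays into a line -/
def glue (α : ℕ → G) (z : G) (a : ℕ) (t : ℕ) : G :=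
  if t ≤ a then α (a - t) else z * α (t - a - 1)

theorem line_qg (h : GS π) {α : ℕ → G} (hα : IsRay π α) {z : G} {C : ℝ} (hC0 : 0 ≤ C)
    (hC : ∀ s t : ℕ, (s : ℝ) + t - C ≤ dd π (α s) (z * α t)) (a n : ℕ) :
    IsDiscreteQG π 1 (C + 1 + dd π 1 z) (glue α z a) n := by
  have hz := dd_nonneg (π := π) 1 z
  apply qg_mk h
  intro i j hij hj
  have hij' : (i : ℝ) ≤ j := by exact_mod_cast hij
  unfold glue
  by_cases hja : j ≤ a
  · have hia : i ≤ a := by omega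
    simp only [hja, hia, if_true]
    rw [ray_dd hα, Nat.cast_sub hja, Nat.cast_sub hia]
    have : |(a : ℝ) - i - (a - j)| = j - i := by rw [abs_of_nonneg] <;> linarith
    rw [this]; constructor <;> linarith
  · by_cases hia : i ≤ a
    · simp only [hja, hia, if_true, if_false]
      obtain ⟨b, rfl⟩ : ∃ b, j = a + b + 1 := ⟨j - a - 1, by omega⟩
      have e : a + b + 1 - a - 1 = b := by omega
      rw [e]
      have c1 := hC (a - i) b
      have c2 := dd_tri h (α (a - i)) 1 (z * α b)
      have c3 := dd_tri h 1 z (z * α b)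
      rw [ray_ddz hα] at c3
      rw [dd_comm h _ 1, ray_dd0 hα] at c2
      rw [Nat.cast_sub hia] at c1 c2
      push_cast
      constructor <;> linarith
    · simp only [hja, hia, if_false]
      rw [dd_left, ray_dd hα]
      have e : |((i - a - 1 : ℕ) : ℝ) - ((j - a - 1 : ℕ) : ℝ)| = j - i := by
        rw [Nat.cast_sub (by omega), Nat.cast_sub (by omega), Nat.cast_sub (by omega),
          Nat.cast_sub (by omega), abs_sub_comm, abs_of_nonneg] <;> push_cast <;> linarith
      rw [e]; constructor <;> linarith

theorem line_morse (h : GS π) {M : MorseGauge} {α : ℕ → G} (hα : IsRay π α)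
    (hM : ∀ n, IsMorsePath π M α n) (z : G) : ∃ M' : MorseGauge, (∀ k c, M k c ≤ M' k c) ∧
    ∀ a n, IsMorsePath π M' (glue α z a) n := by
  set δ := dd π 1 z with hδ
  have hδ0 : 0 ≤ δ := dd_nonneg _ _
  refine ⟨fun k c => max (M k c) (max (Nb M (3 * k) c 0) (Nb M (3 * k) c δ)),
    fun k c => le_max_left _ _, ?_⟩
  intro a n k c hk hc p m hp i j hij hj h0 hm l hl
  unfold glue at h0 hm ⊢
  by_cases hja : j ≤ a
  · have hia : i ≤ a := by omega
    simp only [hja, hia, if_true] at h0 hm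
    obtain ⟨x, h1, h2, h3⟩ := (morse_rev (hM a)) k c hk hc p m hp i j hij hja h0 hm l hl
    refine ⟨x, h1, h2, ?_⟩
    rw [if_pos (h2.trans hja)]
    exact h3.trans (le_max_left _ _)
  · by_cases hia : i ≤ a
    · simp only [hja, hia, if_true, if_false] at h0 hm
      obtain ⟨r, hr, hmin⟩ := exists_argmin (fun i => dd π (p i) 1) m
      by_cases hlr : l ≤ r
      · obtain ⟨y, h1, h2, h3⟩ := nearProj h (hM (a - i)) hk hc le_rfl hp hr
          (fun i hi => hmin i (hi.trans hr)) (i := a - i) (j := 0) le_rfl (Nat.zero_le _)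
          (by rw [h0, dd_self]) (by rw [hα.1, dd_self]) l hlr
        rw [max_eq_left (Nat.zero_le _)] at h2
        refine ⟨a - y, by omega, by omega, ?_⟩
        rw [if_pos (by omega)]
        have e : a - (a - y) = y := by omega
        rw [e]
        exact h3.trans ((le_max_left _ _).trans (le_max_right _ _))
      · obtain ⟨y, h1, h2, h3⟩ := nearProj h (morse_left z (hM (j - a - 1))) hk hc hδ0
          (qg_rev hp) (x := 1) (a := m - r) (by omega)
          (fun i hi => by
            have e : m - (m - r) = r := by omega
            simp only [e]
            exact hmin _ (by omega)) (i := j - a - 1) (j := 0) le_rfl (Nat.zero_le _)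
          (by simp only [Nat.sub_zero]; rw [hm, dd_self]; exact hδ0) (by rw [hα.1, mul_one])
          (m - l) (by omega)
        rw [max_eq_left (Nat.zero_le _)] at h2
        have e : m - (m - l) = l := by omega
        simp only [e] at h3
        refine ⟨a + y + 1, by omega, by omega, ?_⟩
        rw [if_neg (by omega)]
        have e : a + y + 1 - a - 1 = y := by omega
        rw [e]
        exact h3.trans ((le_max_right _ _).trans (le_max_right _ _))
    · simp only [hja, hia, if_false] at h0 hm
      obtain ⟨x, h1, h2, h3⟩ := (morse_left z (hM (j - a - 1))) k c hk hc p m hp (i - a - 1)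
        (j - a - 1) (by omega) le_rfl h0 hm l hl
      refine ⟨a + x + 1, by omega, by omega, ?_⟩
      rw [if_neg (by omega)]
      have e : a + x + 1 - a - 1 = x := by omega
      rw [e]
      exact h3.trans (le_max_left _ _)

theorem ball_finite [Fintype A] (h : GS π) (n : ℕ) : {g : G | wordLength π g ≤ n}.Finite := by
  have : {l : List A | l.length ≤ n}.Finite := List.finite_length_le A n
  refine (this.image (wordEval π)).subset ?_
  intro g hg
  obtain ⟨w, hw, hw'⟩ := exists_geo_word h g
  exact ⟨w, by simpa [hw] using hg, hw'⟩

theorem koenig [Fintype A] (h : GS π) (f : ℕ → ℕ → G) (hf : ∀ n t, wordLength π (f n t) ≤ t) :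
    ∃ φ : ℕ → G, ∀ R, ∃ n ≥ R, ∀ t ≤ R, f n t = φ t := by
  let _ : TopologicalSpace G := ⊥
  have : DiscreteTopology G := ⟨rfl⟩
  have hK : IsCompact (Set.pi Set.univ (fun t : ℕ => {g : G | wordLength π g ≤ t})) :=
    isCompact_univ_pi (fun t => (ball_finite h t).isCompact)
  obtain ⟨φ, -, hφ⟩ := hK.exists_mapClusterPt (f := Filter.atTop) (u := f)
    (by
      apply Filter.tendsto_principal.2
      exact Filter.Eventually.of_forall (fun n t _ => hf n t))
  refine ⟨φ, fun R => ?_⟩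
  have hU : {g : ℕ → G | ∀ t ≤ R, g t = φ t} ∈ nhds φ := by
    have : Set.pi (Set.Iic R) (fun t => ({φ t} : Set G)) ∈ nhds φ :=
      set_pi_mem_nhds (Set.finite_Iic R) (fun t _ => by simp)
    filter_upwards [this] with g hg t ht
    exact hg t ht
  have := (mapClusterPt_iff_frequently.1 hφ) _ hU
  obtain ⟨n, hn, hn'⟩ := (Filter.frequently_atTop.1 this) R
  exact ⟨n, hn, hn'⟩

end Rays
section CaseB
variable {G : Type} [Group G] {A : Type} {π : A → G}

theorem busemann (h : GS π) {α : ℕ → G} (hα : IsRay π α) (x : G) :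
    ∃ b : ℝ, ∃ N : ℕ, ∀ τ ≥ N, dd π x (α τ) = τ + b := by
  let g : ℕ → ℕ := fun τ => wordDist π x (α τ) + wordDist π 1 x - τ
  have hle : ∀ τ, τ ≤ wordDist π x (α τ) + wordDist π 1 x := by
    intro τ
    have h1 := dd_tri h 1 x (α τ)
    rw [ray_dd0 hα] at h1
    have : (τ : ℝ) ≤ wordDist π x (α τ) + wordDist π 1 x := by linarith
    exact_mod_cast this
  have hg : ∀ τ, (g τ : ℝ) = dd π x (α τ) + dd π 1 x - τ := by
    intro τ
    simp only [g]
    rw [Nat.cast_sub (hle τ)]; push_cast; ring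
  have hex : ∃ v, ∃ τ, g τ = v := ⟨_, 0, rfl⟩
  obtain ⟨N, hN⟩ := Nat.find_spec hex
  have hmin : ∀ τ, g N ≤ g τ := fun τ => by
    rw [hN]; exact Nat.find_min' hex ⟨τ, rfl⟩
  refine ⟨dd π x (α N) - N, N, fun τ hτ => ?_⟩
  have h1 : (g N : ℝ) ≤ g τ := by exact_mod_cast hmin τ
  rw [hg, hg] at h1
  have h2 := dd_tri h x (α N) (α τ)
  have h3 := geo_dd_le (ray_geo hα τ) hτ le_rfl
  apply le_antisymm <;> linarith

theorem caseB [Fintype A] (h : GS π) {M : MorseGauge} {α : ℕ → G} (hα : IsRay π α)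
    (hM : ∀ n, IsMorsePath π M α n) (H : Subgroup G) (hn : H.Normal)
    (hinf : (H : Set G).Infinite) (hH : ∀ z ∈ H, Asy π α z) :
    ∃ F : ℝ, ∀ g : G, ∃ x ∈ H, dd π g x ≤ F := by
  choose b N hb using busemann h hα
  have hb1 : b 1 = 0 := by
    have := hb 1 (N 1) le_rfl
    rw [ray_dd0 hα] at this
    linarith
  set D := 3 * Nb M (3 * 1) 0 0 with hD
  have hD0 : 0 ≤ D := by
    have := Nb_nonneg M (3 * 1) 0 (le_refl (0 : ℝ)); linarith
  -- key estimate
  have key : ∀ z x : G, ∃ T : ℕ, ∀ τ ≥ T, ∀ u : ℕ, dd π (z * α u) (α τ) ≤ D →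
      |b (z * x) - b x - ((u : ℝ) - τ)| ≤ D := by
    intro z x
    obtain ⟨K, hK⟩ := exists_nat_ge (dd π 1 z + D)
    refine ⟨N (z * x) + N x + K, fun τ hτ u hu => ?_⟩
    have e1 := hb (z * x) τ (by omega)
    have hu' : N x ≤ u := by
      have a1 := ray_dd0 hα τ
      have a2 := dd_tri h 1 z (α τ)
      have a3 := dd_tri h z (z * α u) (α τ)
      rw [ray_ddz hα] at a3
      have : (τ : ℝ) ≤ K + u := by linarith
      have : τ ≤ K + u := by exact_mod_cast this
      omega
    have e2 := hb x u hu'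
    rw [← dd_left z] at e2
    have t1 := dd_tri h (z * x) (z * α u) (α τ)
    have t2 := dd_tri h (z * x) (α τ) (z * α u)
    rw [dd_comm h (α τ) (z * α u)] at t2
    rw [abs_le]; constructor <;> linarith
  have key1 : ∀ z : G, ∃ T : ℕ, ∀ τ ≥ T, ∀ u : ℕ, dd π (z * α u) (α τ) ≤ D →
      |b z - ((u : ℝ) - τ)| ≤ D := by
    intro z
    obtain ⟨T, hT⟩ := key z 1
    refine ⟨T, fun τ hτ u hu => ?_⟩
    have := hT τ hτ u hu
    rwa [mul_one, hb1, sub_zero] at this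
  have quasi : ∀ z, Asy π α z → ∀ x, |b (z * x) - b x - b z| ≤ 2 * D := by
    intro z hz x
    obtain ⟨T0, hT0⟩ := asym_close h hα hM hz
    obtain ⟨T1, hT1⟩ := key z x
    obtain ⟨T2, hT2⟩ := key1 z
    obtain ⟨u, hu⟩ := hT0 (T0 + T1 + T2) (by omega)
    have a1 := abs_le.1 (hT1 (T0 + T1 + T2) (by omega) u hu)
    have a2 := abs_le.1 (hT2 (T0 + T1 + T2) (by omega) u hu)
    rw [abs_le]; constructor <;> linarith [a1.1, a1.2, a2.1, a2.2]
  have hfin : ∀ R : ℝ, {z | Asy π α z ∧ |b z| ≤ R}.Finite := by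
    intro R
    obtain ⟨K, hK⟩ := exists_nat_ge (R + 2 * D)
    have hB := ball_finite h K
    by_contra hcon
    obtain ⟨s, hs, hcard⟩ := Set.Infinite.exists_subset_card_eq hcon (hB.toFinset.card + 1)
    have hz : ∀ z : G, ∃ T : ℕ, z ∈ s → ∀ τ ≥ T, wordDist π (α τ) (z * α τ) ≤ K := by
      intro z
      by_cases hzs : z ∈ s
      · obtain ⟨hz1, hz2⟩ := hs hzs
        obtain ⟨T0, hT0⟩ := asym_close h hα hM hz1
        obtain ⟨T2, hT2⟩ := key1 z
        refine ⟨T0 + T2, fun _ τ hτ => ?_⟩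
        obtain ⟨u, hu⟩ := hT0 τ (by omega)
        have a2 := abs_le.1 (hT2 τ (by omega) u hu)
        have a3 := abs_le.1 hz2
        have t1 := dd_tri h (z * α τ) (z * α u) (α τ)
        rw [dd_left, ray_dd hα] at t1
        have a4 : |(τ : ℝ) - u| ≤ R + D := by
          rw [abs_le]; constructor <;> linarith [a2.1, a2.2, a3.1, a3.2]
        have : dd π (z * α τ) (α τ) ≤ K := by linarith
        rw [dd_comm h] at this
        exact_mod_cast this
      · exact ⟨0, fun h => absurd h hzs⟩
    choose T hT using hz
    set τ := s.sup T with hτ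
    have : s.card ≤ hB.toFinset.card := by
      apply Finset.card_le_card_of_injOn (fun z => (α τ)⁻¹ * (z * α τ))
      · intro z hz
        have := hT z hz τ (Finset.le_sup hz)
        simpa [wordDist] using this
      · intro z _ z' _ e
        simpa using e
    omega
  have hunb : ∀ R : ℝ, ∃ z ∈ H, R < |b z| := by
    intro R
    by_contra hcon
    push Not at hcon
    exact hinf ((hfin R).subset (fun z hz => ⟨hH z hz, hcon z hz⟩))
  have hAmul : ∀ x y, Asy π α x → Asy π α y → Asy π α (x * y) := by
    rintro x y ⟨C1, h1⟩ ⟨C2, h2⟩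
    refine ⟨C2 + C1, fun t => ?_⟩
    have t1 := dd_tri h (x * y * α t) (x * α t) (α t)
    rw [mul_assoc, dd_left] at t1
    have := h1 t
    have := h2 t
    rw [mul_assoc]
    linarith
  have hbinv : ∀ z ∈ H, |b z + b z⁻¹| ≤ 2 * D := by
    intro z hz
    have := quasi z (hH z hz) z⁻¹
    rw [mul_inv_cancel, hb1] at this
    rw [← abs_neg]; convert this using 2; ring
  -- elements not fixing the endpoint
  have hNA : ∀ g, ¬ Asy π α g → ∃ C : ℝ, ∀ z ∈ H, |b z + b (g⁻¹ * z * g)| ≤ C := by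
    intro g hg
    obtain ⟨C, hC0, hC⟩ := nonasym_dist h hα hM hg
    have h1 : ∀ x, -C ≤ b x + b (g⁻¹ * x) := by
      intro x
      set τ := N x + N (g⁻¹ * x)
      have e1 := hb x τ (by omega)
      have e2 := hb (g⁻¹ * x) τ (by omega)
      rw [← dd_left g, mul_inv_cancel_left] at e2
      have e3 := hC τ τ
      have e4 := dd_tri h (α τ) x (g * α τ)
      rw [dd_comm h (α τ) x] at e4
      linarith
    have h2 : ∀ z ∈ H, -(C + 2 * D + |b g⁻¹|) ≤ b z + b (g⁻¹ * z * g) := by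
      intro z hz
      have hz' : g⁻¹ * z * g ∈ H := by simpa using hn.conj_mem z hz g⁻¹
      have e1 := abs_le.1 (quasi _ (hH _ hz') g⁻¹)
      rw [mul_inv_cancel_right] at e1
      have e2 := h1 z
      have e3 := le_abs_self (b g⁻¹)
      linarith [e1.1, e1.2]
    refine ⟨C + 6 * D + |b g⁻¹|, fun z hz => ?_⟩
    have hz' : g⁻¹ * z * g ∈ H := by simpa using hn.conj_mem z hz g⁻¹
    have e1 := h2 z hz
    have e2 := h2 z⁻¹ (H.inv_mem hz)
    have e3 := abs_le.1 (hbinv z hz)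
    have e4 := abs_le.1 (hbinv _ hz')
    have e5 : (g⁻¹ * z * g)⁻¹ = g⁻¹ * z⁻¹ * g := by group
    rw [e5] at e4
    rw [abs_le]; constructor <;> linarith [e3.1, e3.2, e4.1, e4.2]
  have htriple : ∀ g1 g2, ¬ Asy π α g1 → ¬ Asy π α g2 → Asy π α (g1⁻¹ * g2) := by
    intro g1 g2 hg1 hg2
    by_contra hg3
    obtain ⟨C1, h1⟩ := hNA g1 hg1
    obtain ⟨C2, h2⟩ := hNA g2 hg2
    obtain ⟨C3, h3⟩ := hNA _ hg3
    obtain ⟨z, hz, hzb⟩ := hunb (C1 + C2 + C3)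
    have hz' : g1⁻¹ * z * g1 ∈ H := by simpa using hn.conj_mem z hz g1⁻¹
    have e1 := abs_le.1 (h1 z hz)
    have e2 := abs_le.1 (h2 z hz)
    have e3 := abs_le.1 (h3 _ hz')
    have e : (g1⁻¹ * g2)⁻¹ * (g1⁻¹ * z * g1) * (g1⁻¹ * g2) = g2⁻¹ * z * g2 := by group
    rw [e] at e3
    have c0 : 0 ≤ C1 + C2 + C3 := by linarith [e1.1, e1.2, e2.1, e2.2, e3.1, e3.2]
    have : |b z| ≤ C1 + C2 + C3 := by
      rw [abs_le]; constructor <;> linarith [e1.1, e1.2, e2.1, e2.2, e3.1, e3.2]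
    linarith
  -- coboundedness on the stabilizer
  obtain ⟨u, huH, hu⟩ : ∃ u ∈ H, 2 * D + 1 ≤ b u := by
    obtain ⟨z, hz, hzb⟩ := hunb (4 * D + 1)
    rcases le_total 0 (b z) with h0 | h0
    · rw [abs_of_nonneg h0] at hzb
      exact ⟨z, hz, by linarith⟩
    · rw [abs_of_nonpos h0] at hzb
      have := abs_le.1 (hbinv z hz)
      exact ⟨z⁻¹, H.inv_mem hz, by linarith [this.1]⟩
  obtain ⟨v, hvH, hv⟩ : ∃ v ∈ H, b v ≤ -(2 * D + 1) := by
    obtain ⟨z, hz, hzb⟩ := hunb (4 * D + 1)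
    rcases le_total 0 (b z) with h0 | h0
    · rw [abs_of_nonneg h0] at hzb
      have := abs_le.1 (hbinv z hz)
      exact ⟨z⁻¹, H.inv_mem hz, by linarith [this.2]⟩
    · rw [abs_of_nonpos h0] at hzb
      exact ⟨z, hz, by linarith⟩
  set K := b u - b v + 2 * D with hK
  have hred : ∀ n : ℕ, ∀ z, Asy π α z → |b z| ≤ K + n → ∃ x ∈ H, |b (x * z)| ≤ K := by
    intro n
    induction n with
    | zero => intro z _ hz; exact ⟨1, H.one_mem, by simpa using hz⟩
    | succ n ih =>
      intro z hz hzb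
      by_cases hs : |b z| ≤ K
      · exact ⟨1, H.one_mem, by simpa using hs⟩
      push Not at hs
      push_cast at hzb
      have step : ∃ y ∈ H, |b (y * z)| ≤ K + n := by
        have qu := abs_le.1 (quasi u (hH u huH) z)
        have qv := abs_le.1 (quasi v (hH v hvH) z)
        have hn0 : (0 : ℝ) ≤ n := Nat.cast_nonneg n
        rcases le_total 0 (b z) with h0 | h0
        · rw [abs_of_nonneg h0] at hs hzb
          refine ⟨v, hvH, ?_⟩
          rw [abs_le]; constructor <;> linarith [qv.1, qv.2]
        · rw [abs_of_nonpos h0] at hs hzb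
          refine ⟨u, huH, ?_⟩
          rw [abs_le]; constructor <;> linarith [qu.1, qu.2]
      obtain ⟨y, hy, hyb⟩ := step
      obtain ⟨x, hx, hxb⟩ := ih (y * z) (hAmul _ _ (hH y hy) hz) hyb
      exact ⟨x * y, H.mul_mem hx hy, by rwa [mul_assoc]⟩
  obtain ⟨F, hF⟩ : ∃ F : ℝ, ∀ z, Asy π α z → |b z| ≤ K → dd π 1 z ≤ F := by
    obtain ⟨F, hF⟩ := ((hfin K).image (fun z => dd π 1 z)).bddAbove
    exact ⟨F, fun z h1 h2 => hF ⟨z, ⟨h1, h2⟩, rfl⟩⟩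
  have hSt : ∀ z, Asy π α z → ∃ x ∈ H, dd π 1 (x * z) ≤ F := by
    intro z hz
    obtain ⟨n, hn⟩ := exists_nat_ge (|b z| - K)
    obtain ⟨x, hx, hxb⟩ := hred n z hz (by linarith)
    exact ⟨x, hx, hF _ (hAmul _ _ (hH x hx) hz) hxb⟩
  have conc : ∀ (g x : G), dd π g x⁻¹ = dd π 1 (x * g) := by
    intro g x
    rw [← dd_left x, mul_inv_cancel, dd_comm h]
  by_cases hall : ∀ g, Asy π α g
  · refine ⟨F, fun g => ?_⟩
    obtain ⟨x, hx, hxF⟩ := hSt g (hall g)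
    exact ⟨x⁻¹, H.inv_mem hx, by rwa [conc]⟩
  · push Not at hall
    obtain ⟨g0, hg0⟩ := hall
    refine ⟨F + dd π 1 g0, fun g => ?_⟩
    have hg0p := dd_nonneg (π := π) 1 g0
    by_cases hg : Asy π α g
    · obtain ⟨x, hx, hxF⟩ := hSt g hg
      exact ⟨x⁻¹, H.inv_mem hx, by rw [conc]; linarith⟩
    · obtain ⟨x, hx, hxF⟩ := hSt _ (htriple g0 g hg0 hg)
      refine ⟨(g0 * x * g0⁻¹)⁻¹, H.inv_mem (hn.conj_mem x hx g0), ?_⟩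
      rw [conc]
      have e : g0 * x * g0⁻¹ * g = g0 * (x * (g0⁻¹ * g)) := by group
      rw [e]
      have t := dd_tri h 1 g0 (g0 * (x * (g0⁻¹ * g)))
      have t2 := dd_left (π := π) g0 1 (x * (g0⁻¹ * g))
      rw [mul_one] at t2
      linarith

end CaseB
section Final
variable {G : Type} [Group G] {A : Type} {π : A → G}

theorem morse_prefix {M : MorseGauge} {q : ℕ → G} {n m : ℕ} (hm : m ≤ n)
    (H : IsMorsePath π M q n) : IsMorsePath π M q m := by
  have := morse_sub (Nat.zero_le m) hm H
  simpa using this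

theorem qg_prefix {k c : ℝ} {q : ℕ → G} {n m : ℕ} (hm : m ≤ n)
    (H : IsDiscreteQG π k c q n) : IsDiscreteQG π k c q m :=
  fun i hi j hj => H i (hi.trans hm) j (hj.trans hm)

theorem finalF [Fintype A] (h : GS π) {γ : ℕ → G} (hγ : IsRay π γ) (H : Subgroup G)
    (M : MorseGauge) (k c : ℝ) (hk : 1 ≤ k) (hc : 0 ≤ c)
    (hyp : ∀ R : ℕ, ∃ (q : ℕ → G) (n N : ℕ), R ≤ n ∧ n ≤ N ∧ (∀ i ≤ n, q i = γ i) ∧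
      IsDiscreteQG π k c q N ∧ IsMorsePath π M q N ∧ q N ∈ H) :
    ∃ (M2 : MorseGauge) (γ' : ℕ → G), IsMorseRay π M2 γ' ∧ RayEquiv π γ' γ ∧
      ∃ w : ℕ → List A,
      (∀ n : ℕ, IsGeodesicWord π (w n) ∧ wordEval π (w n) ∈ H ∧
        IsMorsePath π M2 (wordPath π (w n)) (w n).length) ∧
      ConvergesTo π w γ' := by
  obtain ⟨M2, hM2⟩ := geo_morse h M k c hk hc
  choose q n N hRn hnN hq hQG hMo hqH using hyp
  choose w hw1 hw2 using fun R => exists_geo_word h (q R (N R))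
  have hwg : ∀ R, IsGeodesicWord π (w R) := fun R => by
    unfold IsGeodesicWord; rw [hw2, hw1]
  have hgeo := fun R => geo_word_path h (w R) (hwg R)
  have hp0 : ∀ R, wordPath π (w R) 0 = q R 0 := fun R => by
    rw [hq R 0 (Nat.zero_le _), hγ.1]; simp [wordPath, wordEval]
  have hpL : ∀ R, wordPath π (w R) (w R).length = q R (N R) := fun R => by
    simp [wordPath, hw2]
  have hmor : ∀ R, IsMorsePath π M2 (wordPath π (w R)) (w R).length := fun R =>
    hM2 _ _ (hMo R) (hQG R) _ _ (hgeo R) (hp0 R) (hpL R)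
  have hconv : ∀ R m, m ≤ n R → ∃ i ≤ (w R).length,
      dd π (γ m) (wordPath π (w R) i) ≤ Cb M k c 0 := by
    intro R m hm
    have := conv h (hMo R) hk hc le_rfl (hQG R) (hgeo R) (Nat.zero_le _) le_rfl
      (by rw [hp0, dd_self]) (by rw [hpL, dd_self]) m (by simp) (by
        rw [max_eq_right (Nat.zero_le _)]; exact hm.trans (hnN R))
    rw [hq R m hm] at this
    exact this
  obtain ⟨K, hK⟩ := exists_nat_ge (Cb M k c 0)
  have hp1 : ∀ R, wordPath π (w R) 0 = 1 := fun R => by simp [wordPath, wordEval]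
  have hidx : ∀ R m i, i ≤ (w R).length → dd π (γ m) (wordPath π (w R) i) ≤ Cb M k c 0 →
      |(m : ℝ) - i| ≤ K := by
    intro R m i hi hd
    have a1 := geo_dd_le (hgeo R) (Nat.zero_le i) hi
    rw [hp1] at a1
    have a2 := ray_dd0 hγ m
    have t1 := dd_tri h 1 (γ m) (wordPath π (w R) i)
    have t2 := dd_tri h 1 (wordPath π (w R) i) (γ m)
    rw [dd_comm h (wordPath π (w R) i) (γ m)] at t2
    push_cast at *
    rw [abs_le]; constructor <;> linarith
  have hlen : ∀ R, n R ≤ (w R).length + K := by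
    intro R
    obtain ⟨i, hi, hd⟩ := hconv R (n R) le_rfl
    have := (abs_le.1 (hidx _ _ _ hi hd)).2
    have : (n R : ℝ) ≤ i + K := by linarith
    have : n R ≤ i + K := by exact_mod_cast this
    omega
  have hclose : ∀ R m, m ≤ n R → m ≤ (w R).length →
      wordDist π (wordPath π (w R) m) (γ m) ≤ 2 * K := by
    intro R m hm hm'
    obtain ⟨i, hi, hd⟩ := hconv R m hm
    have a1 := hidx _ _ _ hi hd
    have a2 := geo_dd (hgeo R) hm' hi
    have t := dd_tri h (wordPath π (w R) m) (wordPath π (w R) i) (γ m)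
    rw [dd_comm h _ (γ m)] at t
    rw [dd_comm h (wordPath π (w R) i) (γ m)] at t
    rw [wd_comm h]
    have : dd π (γ m) (wordPath π (w R) m) ≤ 2 * K := by linarith
    exact_mod_cast this
  obtain ⟨φ, hφ⟩ := koenig h (fun R => wordPath π (w R)) (fun R t => wordPath_len _ t)
  choose r hr hr' using fun R => hφ (R + K)
  have hrlen : ∀ R, R ≤ (w (r R)).length := by
    intro R
    have := hlen (r R)
    have := hRn (r R)
    have := hr R
    omega
  have hrφ : ∀ R, ∀ t ≤ R, wordPath π (w (r R)) t = φ t := fun R t ht => hr' R t (by omega)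
  refine ⟨M2, φ, ⟨⟨?_, ?_⟩, ?_⟩, ⟨2 * K, ?_⟩, fun R => w (r R), fun R => ⟨hwg _, ?_, hmor _⟩, ?_⟩
  · rw [← hrφ 0 0 le_rfl, hp1]
  · intro i j
    rw [← hrφ (max i j) i (le_max_left _ _), ← hrφ (max i j) j (le_max_right _ _)]
    exact hgeo _ i ((le_max_left _ _).trans (hrlen _)) j ((le_max_right _ _).trans (hrlen _))
  · intro m
    exact morse_congr (hrφ m) (morse_prefix (hrlen m) (hmor _))
  · intro m
    rw [← hrφ m m le_rfl]
    refine hclose _ m ?_ (hrlen m)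
    have := hRn (r m)
    have := hr m
    omega
  · rw [hw2]; exact hqH _
  · intro m
    exact ⟨m, fun R hR => ⟨hR.trans (hrlen R), fun t ht => hrφ R t (ht.trans hR)⟩⟩

theorem main_aux [Fintype A] (h : GS π) (hltg : MorseLocalToGlobal π) (H : Subgroup G)
    (hn : H.Normal) (hinf : (H : Set G).Infinite) {γ : ℕ → G} (hγ : IsRay π γ)
    {M : MorseGauge} (hM : ∀ n, IsMorsePath π M γ n) :
    ∃ (M' : MorseGauge) (k c : ℝ), 1 ≤ k ∧ 0 ≤ c ∧
     ∀ R : ℕ, ∃ (q : ℕ → G) (n N : ℕ), R ≤ n ∧ n ≤ N ∧ (∀ i ≤ n, q i = γ i) ∧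
      IsDiscreteQG π k c q N ∧ IsMorsePath π M' q N ∧ q N ∈ H := by
  obtain ⟨α, hαl⟩ := koenig h (fun n t => (γ n)⁻¹ * γ (n - t)) (fun n t => by
    have := hγ.2 n (n - t)
    unfold wordDist at this
    rw [this]; simp only [Nat.dist]; omega)
  have hα : IsRay π α := by
    refine ⟨?_, fun i j => ?_⟩
    · obtain ⟨n, -, hn⟩ := hαl 0
      rw [← hn 0 le_rfl]; simp
    · obtain ⟨n, hn1, hn⟩ := hαl (max i j)
      have hi : i ≤ n := (le_max_left _ _).trans hn1
      have hj : j ≤ n := (le_max_right _ _).trans hn1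
      rw [← hn i (le_max_left _ _), ← hn j (le_max_right _ _), wd_left, hγ.2]
      simp only [Nat.dist]; omega
  have hαM : ∀ m, IsMorsePath π M α m := by
    intro m
    obtain ⟨n, hn1, hn⟩ := hαl m
    exact morse_congr hn (morse_prefix hn1 (morse_left (γ n)⁻¹ (morse_rev (hM n))))
  by_cases hH : ∀ z ∈ H, Asy π α z
  · obtain ⟨F, hF⟩ := caseB h hα hαM H hn hinf hH
    choose x hxH hx using hF
    have hF0 : 0 ≤ F := (dd_nonneg _ _).trans (hx 1)
    refine ⟨fun k c => Nb M k c F + F, 1, F + 1, le_rfl, by linarith, fun R => ?_⟩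
    refine ⟨fun i => if i ≤ R then γ i else x (γ R), R, R + 1, le_rfl, by omega,
      fun i hi => by simp [hi], ?_, ?_, ?_⟩
    · apply qg_mk h
      intro i j hij hj
      have hij' : (i : ℝ) ≤ j := by exact_mod_cast hij
      by_cases hjR : j ≤ R
      · have hiR : i ≤ R := by omega
        simp only [hjR, hiR, if_true]
        rw [geo_dd_le (ray_geo hγ j) hij le_rfl]
        constructor <;> linarith
      · obtain rfl : j = R + 1 := by omega
        by_cases hiR : i ≤ R
        · simp only [hjR, hiR, if_true, if_false]
          have e := geo_dd_le (ray_geo hγ R) hiR le_rfl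
          have t1 := dd_tri h (γ i) (γ R) (x (γ R))
          have t2 := dd_tri h (γ i) (x (γ R)) (γ R)
          rw [dd_comm h (x (γ R)) (γ R)] at t2
          have := hx (γ R)
          push_cast at *
          constructor <;> linarith
        · obtain rfl : i = R + 1 := by omega
          simp only [hjR, if_false]
          rw [dd_self]
          constructor <;> linarith
    · intro k c hk hc p m hp i j hij hj h0 hm l hl
      have hcl : ∀ i ≤ R + 1, dd π (if i ≤ R then γ i else x (γ R)) (γ (min i R)) ≤ F := by
        intro i hi
        split_ifs with h1
        · rw [min_eq_left h1, dd_self]; exact hF0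
        · rw [min_eq_right (by omega), dd_comm h]; exact hx _
      obtain ⟨y, hy1, hy2, hy3⟩ := near h (hM R) hk hc hF0 hp (i := min i R) (j := min j R)
        (min_le_right _ _) (min_le_right _ _) (by rw [h0]; exact hcl i (by omega))
        (by rw [hm]; exact hcl j hj) l hl
      by_cases hiR : i ≤ R
      · refine ⟨y, by omega, by omega, ?_⟩
        have hyR : y ≤ R := by omega
        simp only [hyR, if_true]
        exact hy3.trans (by linarith)
      · refine ⟨i, le_rfl, hij, ?_⟩
        obtain rfl : y = R := by omega
        simp only [hiR, if_false]
        have t := dd_tri h (p l) (γ y) (x (γ y))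
        have := hx (γ y)
        linarith
    · simpa using hxH (γ R)
  · push Not at hH
    obtain ⟨z, hzH, hz⟩ := hH
    obtain ⟨C, hC0, hC⟩ := nonasym_dist h hα hαM hz
    obtain ⟨M', hMM', hM'⟩ := line_morse h hα hαM z
    have hz0 := dd_nonneg (π := π) 1 z
    have hc0 : 0 ≤ C + 1 + dd π 1 z := by linarith
    obtain ⟨B, M'', k', c', hB, hk', hc', hBq⟩ := hltg M' 1 (C + 1 + dd π 1 z) le_rfl hc0
    refine ⟨M'', k', c', hk', hc', fun R => ?_⟩
    obtain ⟨B', hB'⟩ := exists_nat_ge B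
    obtain ⟨n, hn1, hnα⟩ := hαl (R + B')
    set f : ℕ → G := fun t => (γ n)⁻¹ * γ (n - t) with hf
    have hnα' : ∀ t ≤ R + B', f t = α t := hnα
    have hq1 : ∀ i ≤ n, γ n * glue f z n i = γ i := by
      intro i hi
      have e : n - (n - i) = i := by omega
      simp [glue, hi, hf, e]
    have hloc := hBq (fun i => γ n * glue f z n i) (2 * n + 1) ?_
    · refine ⟨fun i => γ n * glue f z n i, n, 2 * n + 1, by omega, by omega, hq1, hloc.1, hloc.2, ?_⟩
      have e0 : ¬ (2 * n + 1 ≤ n) := by omega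
      have e1 : n - (2 * n + 1 - n - 1) = 0 := by omega
      simp only [glue, e0, if_false, hf, e1, hγ.1, mul_one]
      rw [← mul_assoc]
      exact hn.conj_mem z hzH (γ n)
    · intro i j hij hj hijB
      have hijB' : j ≤ i + B' := by
        have : (j : ℝ) ≤ i + B' := by linarith
        exact_mod_cast this
      by_cases hjn : j ≤ n
      · have e : ∀ t ≤ j - i, γ (i + t) = γ n * glue f z n (i + t) := fun t ht =>
          (hq1 (i + t) (by omega)).symm
        exact ⟨qg_congr e (qg_mono le_rfl le_rfl hc0 (qg_sub hij le_rfl (geo_qg (ray_geo hγ j)))),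
          morse_congr e (morse_mono hMM' (morse_sub hij le_rfl (hM j)))⟩
      · by_cases hin : i ≤ n
        · have e : ∀ t ≤ j - i, γ n * glue α z (n - i) t = γ n * glue f z n (i + t) := by
            intro t ht
            congr 1
            unfold glue
            by_cases hit : i + t ≤ n
            · rw [if_pos (by omega), if_pos hit, hnα' _ (by omega)]
              congr 1; omega
            · rw [if_neg (by omega), if_neg hit, hnα' _ (by omega)]
              congr 2; omega
          exact ⟨qg_congr e (qg_left _ (line_qg h hα hC0 hC _ _)),
            morse_congr e (morse_left _ (hM' _ _))⟩
        · have e : ∀ t ≤ j - i, (γ n * z * (γ n)⁻¹) * γ (2 * n + 1 - i - t) =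
              γ n * glue f z n (i + t) := by
            intro t ht
            unfold glue
            rw [if_neg (by omega)]
            have e1 : n - (i + t - n - 1) = 2 * n + 1 - i - t := by omega
            simp only [hf, e1, mul_assoc]
          exact ⟨qg_congr e (qg_mono le_rfl le_rfl hc0 (qg_left _
              (qg_prefix (by omega) (qg_rev (geo_qg (ray_geo hγ (2 * n + 1 - i))))))),
            morse_congr e (morse_mono hMM' (morse_left _
              (morse_prefix (by omega) (morse_rev (hM (2 * n + 1 - i))))))⟩

end Final

/-- If `H` is an infinite normal subgroup of a Morse
local-to-global group `G` containing a Morse element, then the limit set of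
`H` is the whole Morse boundary. -/
theorem limitSet_of_normal_eq_boundary {G : Type} [Group G] {A : Type} [Fintype A]
    (π : A → G) (hgen : Generates π) (hsym : SymmetricGen π)
    (hltg : MorseLocalToGlobal π)
    (H : Subgroup G) (hnormal : H.Normal) (hinf : (H : Set G).Infinite)
    (hmorse : ∃ h ∈ H, IsMorseElement π h) :
    limitSet π H = Set.univ := by
  have h : GS π := ⟨hgen, hsym⟩
  apply Set.eq_univ_of_forall
  intro x
  obtain ⟨⟨γ, M, hγ⟩, rfl⟩ := Quot.exists_rep x
  obtain ⟨M', k, c, hk, hc, hyp⟩ := main_aux h hltg H hnormal hinf hγ.1 hγ.2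
  obtain ⟨M2, γ', hγ', heq, w, hw1, hw2⟩ := finalF h hγ.1 H M' k c hk hc hyp
  exact ⟨M2, γ', hγ', Quot.sound heq, w, hw1, hw2⟩
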